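/- Let L be the Niemeier lattice A_17 A_1 ⊂ ℚ^{18} ⊕ ℚ² generated by A_17 ⊕ A_1 and the glue vector ((1/6^{15}, -5/6^3), (1/2, -1/2)). Then w = ((7/6, 1/6^{13}, -5/6^4), (1/2, -1/2)) lies in L, has norm 5, is extremal, and exactly 4 roots u ∈ L satisfy u·w = -2; hence |Min(w+2L)/±| ≡ 1 + 4 ≡ 1 (mod 2). -/

import Mathlib

/-- The standard inner product on `ℚ^20`. -/
def qip (x y : Fin 20 → ℚ) : ℚ := ∑ i, x i * y i

/-- A rational vector with all coordinates integral. -/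
def isIntVec (x : Fin 20 → ℚ) : Prop := ∀ i, ∃ m : ℤ, x i = (m : ℚ)

/-- The root lattice `A_17` (coordinates `0,…,17`). -/
def A17a : Set (Fin 20 → ℚ) :=
  {x | isIntVec x ∧ (∑ i, x i) = 0 ∧ ∀ i : Fin 20, 18 ≤ i.val → x i = 0}

/-- The root lattice `A_1` (coordinates `18, 19`). -/
def A1b : Set (Fin 20 → ℚ) :=
  {x | isIntVec x ∧ (∑ i, x i) = 0 ∧ ∀ i : Fin 20, i.val < 18 → x i = 0}

/-- The glue vector `g = ((1/6^15, -5/6^3), (1/2, -1/2))`. -/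
def glueA17A1 : Fin 20 → ℚ := fun i =>
  if i.val < 15 then 1 / 6 else if i.val < 18 then -(5 / 6)
  else if i.val = 18 then 1 / 2 else -(1 / 2)

/-- The Niemeier lattice `A_17 A_1`. -/
def NiemeierA17A1 : AddSubgroup (Fin 20 → ℚ) :=
  AddSubgroup.closure (A17a ∪ A1b ∪ {glueA17A1})

/-- The vector `w = ((7/6, 1/6^13, -5/6^4), (1/2, -1/2))`. -/
def wA17A1 : Fin 20 → ℚ := fun i =>
  if i.val = 0 then 7 / 6 else if i.val < 14 then 1 / 6
  else if i.val < 18 then -(5 / 6) else if i.val = 18 then 1 / 2 else -(1 / 2)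

theorem sum_fin_twenty {M : Type*} [AddCommMonoid M] (f : Fin 20 → M) :
    ∑ i, f i = ∑ i : Fin 18, f (Fin.castAdd 2 i) + (f 18 + f 19) := by
  have h := Fin.sum_univ_add (a := 18) (b := 2) f
  rw [Fin.sum_univ_two] at h
  exact h

/-- Coordinates of the vectors of `NiemeierA17A1`. -/
theorem exists_coords {u : Fin 20 → ℚ} (hu : u ∈ NiemeierA17A1) :
    ∃ (k : ℤ) (t : Fin 18 → ℤ) (m : ℤ),
      (∀ i, u (Fin.castAdd 2 i) = ((k + 6 * t i : ℤ) : ℚ) / 6) ∧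
      u 18 = k / 2 + m ∧ u 19 = -(k / 2 + m) ∧ ∑ i, (k + 6 * t i) = 0 := by
  induction hu using AddSubgroup.closure_induction with
  | mem x hx =>
    rcases hx with (⟨hint, hsum, h0⟩ | ⟨hint, hsum, h0⟩) | rfl
    · choose n hn using hint
      have h18 : x 18 = 0 := h0 18 (by decide)
      have h19 : x 19 = 0 := h0 19 (by decide)
      refine ⟨0, fun i => n (Fin.castAdd 2 i), 0, fun i => ?_, by simp [h18], by simp [h19], ?_⟩
      · rw [hn]; push_cast; ring
      · rw [sum_fin_twenty, h18, h19] at hsum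
        simp only [hn, add_zero] at hsum
        rw [← Int.cast_sum, Int.cast_eq_zero] at hsum
        simp only [zero_add, ← Finset.mul_sum, hsum, mul_zero]
    · choose n hn using hint
      have hx0 : ∀ i : Fin 18, x (Fin.castAdd 2 i) = 0 := fun i => h0 _ i.isLt
      rw [sum_fin_twenty] at hsum
      simp only [hx0, Finset.sum_const_zero, zero_add] at hsum
      refine ⟨0, 0, n 18, fun i => by simp [hx0], by simp [hn], ?_, by simp⟩
      rw [← hn]; push_cast; linarith
    · refine ⟨1, fun i => if i.val < 15 then 0 else -1, 0, fun i => ?_, ?_, ?_, ?_⟩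
      · by_cases h : i.val < 15 <;> (simp [glueA17A1, h]; try norm_num)
      · simp [glueA17A1]
      · simp [glueA17A1]
      · decide
  | zero => exact ⟨0, 0, 0, by simp, by simp, by simp, by simp⟩
  | add x y _ _ hx hy =>
    obtain ⟨k, t, m, h1, h2, h3, h4⟩ := hx
    obtain ⟨k', t', m', h1', h2', h3', h4'⟩ := hy
    refine ⟨k + k', t + t', m + m', fun i => ?_, ?_, ?_, ?_⟩
    · rw [Pi.add_apply, h1, h1', Pi.add_apply]; push_cast; ring
    · rw [Pi.add_apply, h2, h2']; push_cast; ring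
    · rw [Pi.add_apply, h3, h3']; push_cast; ring
    · rw [← add_zero (0 : ℤ)]
      nth_rewrite 1 [← h4]
      rw [← h4', ← Finset.sum_add_distrib]
      exact Finset.sum_congr rfl fun i _ => by rw [Pi.add_apply]; ring
  | neg x _ hx =>
    obtain ⟨k, t, m, h1, h2, h3, h4⟩ := hx
    refine ⟨-k, -t, -m, fun i => ?_, ?_, ?_, ?_⟩
    · rw [Pi.neg_apply, h1, Pi.neg_apply]; push_cast; ring
    · rw [Pi.neg_apply, h2]; push_cast; ring
    · rw [Pi.neg_apply, h3]; push_cast; ring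
    · rw [← neg_zero, ← h4, ← Finset.sum_neg_distrib]
      exact Finset.sum_congr rfl fun i _ => by rw [Pi.neg_apply]; ring

/-- The difference of two standard basis vectors. -/
def diffSingle (i j : Fin 20) : Fin 20 → ℚ := Pi.single i 1 - Pi.single j 1

theorem diffSingle_mem {i j : Fin 20} (hi : i.val < 18) (hj : j.val < 18) :
    diffSingle i j ∈ NiemeierA17A1 := by
  refine AddSubgroup.subset_closure (Or.inl (Or.inl ⟨fun l => ?_, ?_, fun l hl => ?_⟩))
  · refine ⟨(if l = i then 1 else 0) - (if l = j then 1 else 0), ?_⟩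
    simp only [diffSingle, Pi.sub_apply, Pi.single_apply]
    push_cast
    rfl
  · simp [diffSingle]
  · have h1 : l ≠ i := by rintro rfl; omega
    have h2 : l ≠ j := by rintro rfl; omega
    simp [diffSingle, h1, h2]

theorem wA17A1_eq : wA17A1 = glueA17A1 + diffSingle 0 14 := by
  funext i
  fin_cases i <;> simp [wA17A1, glueA17A1, diffSingle] <;> norm_num

theorem wA17A1_mem : wA17A1 ∈ NiemeierA17A1 := by
  rw [wA17A1_eq]
  exact add_mem (AddSubgroup.subset_closure (Or.inr rfl))
    (diffSingle_mem (by decide) (by decide))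

theorem qip_wA17A1_self : qip wA17A1 wA17A1 = 5 := by
  simp [qip, wA17A1, Fin.sum_univ_succ]
  norm_num

theorem le_sum_sq_of_affine_bound (y c : Fin 18 → ℤ) (a : ℤ) (hy : ∑ i, y i = 0)
    (h : ∀ i, c i + a * y i ≤ y i * y i) : ∑ i, c i ≤ ∑ i, y i * y i := by
  have := Finset.sum_le_sum fun i (_ : i ∈ Finset.univ) => h i
  rwa [Finset.sum_add_distrib, ← Finset.mul_sum, hy, mul_zero, add_zero] at this

/-- An integer cannot lie strictly between `t` and `t + 1`. -/
theorem mul_succ_nonneg (t : ℤ) : 0 ≤ t * (t + 1) := by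
  rcases le_or_gt 0 t with h | h
  · positivity
  · nlinarith

theorem le_sum_sq_extremal (k : ℤ) (e t : Fin 18 → ℤ) (he : ∀ i, e i = 0 ∨ e i = 1)
    (hs : ∑ i, e i = 5) (h0 : ∑ i, (1 + 2 * k + 6 * e i + 12 * t i) = 0) :
    162 ≤ ∑ i, (1 + 2 * k + 6 * e i + 12 * t i) * (1 + 2 * k + 6 * e i + 12 * t i) := by
  obtain ⟨q, r, hr0, hr6, rfl⟩ : ∃ q r : ℤ, 0 ≤ r ∧ r < 6 ∧ k = 6 * q + r :=
    ⟨k / 6, k % 6, by omega, by omega, by omega⟩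
  obtain ⟨a, c0, c1, hc, hb⟩ : ∃ a c0 c1 : ℤ, 162 ≤ 13 * c0 + 5 * c1 ∧ ∀ s : ℤ,
      c0 + a * (1 + 2 * r + 12 * s) ≤ (1 + 2 * r + 12 * s) * (1 + 2 * r + 12 * s) ∧
      c1 + a * (7 + 2 * r + 12 * s) ≤ (7 + 2 * r + 12 * s) * (7 + 2 * r + 12 * s) := by
    interval_cases r
    · exact ⟨2, -1, 35, by norm_num, fun s => by
        constructor <;> nlinarith [mul_succ_nonneg s, sq_nonneg s]⟩
    · exact ⟨0, 9, 9, by norm_num, fun s => by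
        constructor <;> nlinarith [mul_succ_nonneg s, mul_succ_nonneg (-s), sq_nonneg (s + 1)]⟩
    · exact ⟨0, 25, 1, by norm_num, fun s => by
        constructor <;> nlinarith [mul_succ_nonneg s, mul_succ_nonneg (s + 1), sq_nonneg (s + 1)]⟩
    · exact ⟨0, 25, 1, by norm_num, fun s => by
        constructor <;> nlinarith [mul_succ_nonneg s, mul_succ_nonneg (s + 1), sq_nonneg (s + 1)]⟩
    · exact ⟨0, 9, 9, by norm_num, fun s => by
        constructor <;> nlinarith [mul_succ_nonneg s, mul_succ_nonneg (s + 1), sq_nonneg (s + 1)]⟩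
    · exact ⟨-2, -1, 35, by norm_num, fun s => by
        constructor <;> nlinarith [mul_succ_nonneg s, mul_succ_nonneg (s + 1), sq_nonneg (s + 1)]⟩
  refine le_trans ?_ (le_sum_sq_of_affine_bound _ (fun i => c0 + e i * (c1 - c0)) a h0 fun i => ?_)
  · rw [Finset.sum_add_distrib, ← Finset.sum_mul, hs]
    simp
    linarith
  · have := hb (q + t i)
    rcases he i with h | h <;> simp only [h]
    · convert this.1 using 1 <;> ring
    · convert this.2 using 1 <;> ring

theorem wA17A1_extremal {u : Fin 20 → ℚ} (hu : u ∈ NiemeierA17A1) :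
    5 ≤ qip (wA17A1 + 2 • u) (wA17A1 + 2 • u) := by
  obtain ⟨k, t, m, h1, h2, h3, h4⟩ := exists_coords hu
  let e : Fin 18 → ℤ := fun i => if i.val = 0 ∨ 14 ≤ i.val then 1 else 0
  let s : Fin 18 → ℤ := fun i => if 14 ≤ i.val then -1 else 0
  have hw : ∀ i : Fin 18, wA17A1 (Fin.castAdd 2 i) = ((1 + 6 * e i + 12 * s i : ℤ) : ℚ) / 6 := by
    intro i
    fin_cases i <;> simp [wA17A1, e, s] <;> norm_num
  have hsum : ∑ i, (1 + 2 * k + 6 * e i + 12 * (t i + s i)) = 0 := by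
    have hes : ∑ i, (1 + 6 * e i + 12 * s i) = 0 := by decide
    have : ∑ i, (1 + 2 * k + 6 * e i + 12 * (t i + s i)) =
        ∑ i, (1 + 6 * e i + 12 * s i) + 2 * ∑ i, (k + 6 * t i) := by
      rw [Finset.mul_sum, ← Finset.sum_add_distrib]
      exact Finset.sum_congr rfl fun i _ => by ring
    rw [this, hes, h4]; rfl
  have hb := le_sum_sq_extremal k e (fun i => t i + s i)
    (fun i => by simp only [e]; split_ifs <;> simp) (by decide) hsum
  have hx : ∀ i : Fin 18, (wA17A1 + 2 • u) (Fin.castAdd 2 i) =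
      ((1 + 2 * k + 6 * e i + 12 * (t i + s i) : ℤ) : ℚ) / 6 := by
    intro i
    rw [Pi.add_apply, Pi.smul_apply, hw, h1, nsmul_eq_mul]
    push_cast; ring
  have hx18 : (wA17A1 + 2 • u) 18 = 1 / 2 + (k + 2 * m) := by
    rw [Pi.add_apply, Pi.smul_apply, h2, nsmul_eq_mul]
    simp [wA17A1]; ring
  have hx19 : (wA17A1 + 2 • u) 19 = -(1 / 2 + (k + 2 * m)) := by
    rw [Pi.add_apply, Pi.smul_apply, h3, nsmul_eq_mul]
    simp [wA17A1]; ring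
  rw [qip, sum_fin_twenty, hx18, hx19]
  simp only [hx]
  have hz : (0 : ℚ) ≤ ((k + 2 * m : ℤ) : ℚ) * (((k + 2 * m : ℤ) : ℚ) + 1) := by
    exact_mod_cast mul_succ_nonneg (k + 2 * m)
  have hb' : (162 : ℚ) ≤ ((∑ i, (1 + 2 * k + 6 * e i + 12 * (t i + s i)) *
      (1 + 2 * k + 6 * e i + 12 * (t i + s i)) : ℤ) : ℚ) := by exact_mod_cast hb
  have hd : ∀ y : ℤ, (y : ℚ) / 6 * ((y : ℚ) / 6) = ((y * y : ℤ) : ℚ) / 36 := by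
    intro y; push_cast; ring
  simp only [hd]
  rw [← Finset.sum_div, ← Int.cast_sum]
  push_cast at hz hb' ⊢
  nlinarith

theorem dvd_of_sum_sq_le (k : ℤ) (t : Fin 18 → ℤ) (h0 : ∑ i, (k + 6 * t i) = 0)
    (h : ∑ i, (k + 6 * t i) * (k + 6 * t i) ≤ 72) : ∃ q, k = 6 * q := by
  obtain ⟨q, r, hr0, hr6, rfl⟩ : ∃ q r : ℤ, 0 ≤ r ∧ r < 6 ∧ k = 6 * q + r :=
    ⟨k / 6, k % 6, by omega, by omega, by omega⟩
  rcases hr0.eq_or_lt with rfl | hr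
  · exact ⟨q, by ring⟩
  have hc := le_sum_sq_of_affine_bound _ (fun _ => r * (6 - r)) (2 * r - 6) h0 fun i => by
    nlinarith [mul_succ_nonneg (q + t i)]
  simp at hc
  nlinarith

theorem eq_diffSingle_of_root {u : Fin 20 → ℚ} (hu : u ∈ NiemeierA17A1) (hn : qip u u = 2)
    (hw : qip u wA17A1 = -2) :
    u = diffSingle 14 0 ∨ u = diffSingle 15 0 ∨ u = diffSingle 16 0 ∨ u = diffSingle 17 0 := by
  obtain ⟨k, t, m, h1, h2, h3, h4⟩ := exists_coords hu
  have hd : ∀ y : ℤ, (y : ℚ) / 6 * ((y : ℚ) / 6) = ((y * y : ℤ) : ℚ) / 36 := by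
    intro y; push_cast; ring
  obtain ⟨q, rfl⟩ : ∃ q, k = 6 * q := by
    refine dvd_of_sum_sq_le k t h4 ?_
    rw [qip, sum_fin_twenty, h2, h3] at hn
    simp only [h1, hd] at hn
    rw [← Finset.sum_div, ← Int.cast_sum] at hn
    have : ((∑ i, (k + 6 * t i) * (k + 6 * t i) : ℤ) : ℚ) ≤ 72 := by
      nlinarith [mul_self_nonneg ((k : ℚ) / 2 + m)]
    exact_mod_cast this
  obtain ⟨p, hp⟩ : ∃ p : Fin 18 → ℤ, ∀ i, p i = q + t i := ⟨_, fun _ => rfl⟩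
  obtain ⟨z, hz⟩ : ∃ z : ℤ, z = 3 * q + m := ⟨_, rfl⟩
  have hu1 : ∀ i, u (Fin.castAdd 2 i) = p i := fun i => by
    rw [h1, hp]; push_cast; ring
  have hu18 : u 18 = z := by rw [h2, hz]; push_cast; ring
  have hu19 : u 19 = -z := by rw [h3, hz]; push_cast; ring
  have hp0 : ∑ i, p i = 0 := by
    have : ∑ i, (6 * q + 6 * t i) = 6 * ∑ i, p i := by
      rw [Finset.mul_sum]
      exact Finset.sum_congr rfl fun i _ => by rw [hp]; ring
    omega
  have hnorm : ∑ i, p i * p i + 2 * (z * z) = 2 := by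
    rw [qip, sum_fin_twenty, hu18, hu19] at hn
    simp only [hu1] at hn
    have : ((∑ i, p i * p i + 2 * (z * z) : ℤ) : ℚ) = 2 := by
      push_cast; linarith
    exact_mod_cast this
  let c : Fin 18 → ℤ := fun i => if i.val = 0 then -1 else if i.val < 14 then 0 else 1
  have hwc : ∀ i : Fin 18, wA17A1 (Fin.castAdd 2 i) = 1 / 6 - c i := by
    intro i
    fin_cases i <;> simp [wA17A1, c] <;> norm_num
  have hdot : ∑ i, c i * p i = 2 + z := by
    rw [qip, sum_fin_twenty, hu18, hu19] at hw
    simp only [hu1, hwc, mul_sub, Finset.sum_sub_distrib] at hw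
    rw [← Finset.sum_mul, ← Int.cast_sum, hp0] at hw
    simp [wA17A1] at hw
    have : ((∑ i, c i * p i : ℤ) : ℚ) = 2 + z := by
      push_cast
      simp only [mul_comm (c _ : ℚ)]
      linarith
    exact_mod_cast this
  have hnonneg : ∀ i, 0 ≤ p i * p i - c i * p i := by
    intro i
    have h1 := mul_succ_nonneg (p i)
    have h2 := mul_succ_nonneg (-p i)
    simp only [c]
    split_ifs <;> nlinarith
  have hsum : ∑ i, (p i * p i - c i * p i) = -z - 2 * (z * z) := by
    rw [Finset.sum_sub_distrib]
    linarith
  have hz0 : z = 0 := by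
    have h := Finset.sum_nonneg fun i (_ : i ∈ Finset.univ) => hnonneg i
    rw [hsum] at h
    have hz1 : z < 1 := by nlinarith
    have hz2 : -1 < z := by nlinarith
    omega
  rw [hz0] at hsum hu18 hu19
  have hpc : ∀ i, p i = 0 ∨ p i = c i := by
    intro i
    have h := (Finset.sum_eq_zero_iff_of_nonneg fun i _ => hnonneg i).1 hsum i (Finset.mem_univ i)
    rw [← sub_mul, mul_eq_zero, sub_eq_zero] at h
    exact h.symm
  have hmid : ∀ i : Fin 18, i ≠ 0 → i.val < 14 → p i = 0 := fun i hi hi' => by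
    simpa [c, hi, hi'] using hpc i
  have hlast : p 0 + p 14 + p 15 + p 16 + p 17 = 0 ∧ -p 0 + p 14 + p 15 + p 16 + p 17 = 2 := by
    have hext : ∀ f : Fin 18 → ℤ, (∀ i : Fin 18, i ≠ 0 → i.val < 14 → f i = 0) →
        ∑ i, f i = f 0 + f 14 + f 15 + f 16 + f 17 := by
      intro f hf
      rw [← Finset.sum_subset (Finset.subset_univ {0, 14, 15, 16, 17})]
      · simp [add_assoc]
      · intro i _ hi
        have : i ≠ 0 ∧ i.val < 14 := by revert i; decide
        exact hf i this.1 this.2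
    refine ⟨(hext p hmid).symm.trans hp0, ?_⟩
    rw [hext _ fun i hi hi' => by rw [hmid i hi hi', mul_zero], hz0] at hdot
    simpa [c] using hdot
  obtain ⟨ha, hb⟩ := hlast
  have hext : ∀ j : Fin 18, 14 ≤ j.val → p 0 = -1 → p j = 1 →
      (∀ i : Fin 18, i ≠ j → 14 ≤ i.val → p i = 0) → u = diffSingle (Fin.castAdd 2 j) 0 := by
    intro j hj hp0 hpj hpi
    funext i
    refine Fin.addCases (m := 18) (n := 2) (fun i => ?_) (fun i => ?_) i
    · rw [hu1]
      have hinj (a b : Fin 18) : (Fin.castAdd 2 a : Fin 20) = Fin.castAdd 2 b ↔ a = b :=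
        Fin.castAdd_inj
      have hinj0 (a : Fin 18) : (Fin.castAdd 2 a : Fin 20) = 0 ↔ a = 0 := hinj a 0
      have hj0 : j ≠ 0 := by rintro rfl; simp at hj
      simp only [diffSingle, Pi.sub_apply, Pi.single_apply, hinj, hinj0]
      by_cases hij : i = j
      · subst hij; simp [hpj, hj0]
      by_cases hi0 : i = 0
      · subst hi0; simp [hp0, hij]
      have : p i = 0 := by
        rcases lt_or_ge i.val 14 with h | h
        · exact hmid i hi0 h
        · exact hpi i hij h
      simp [this, hij, hi0]
    · have hz : u (Fin.natAdd 18 i) = 0 := by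
        fin_cases i
        · exact hu18.trans (by simp)
        · exact hu19.trans (by simp)
      have h1 : Fin.natAdd 18 i ≠ Fin.castAdd 2 j := by
        intro h; have := congrArg Fin.val h; simp at this; omega
      have h2 : Fin.natAdd 18 i ≠ (0 : Fin 20) := by
        intro h; have := congrArg Fin.val h; simp at this
      rw [hz]
      simp [diffSingle, h1, h2]
  have h14 : p 14 = 0 ∨ p 14 = 1 := hpc 14
  have h15 : p 15 = 0 ∨ p 15 = 1 := hpc 15
  have h16 : p 16 = 0 ∨ p 16 = 1 := hpc 16
  have h17 : p 17 = 0 ∨ p 17 = 1 := hpc 17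
  have hcases : ∀ i : Fin 18, 14 ≤ i.val → i = 14 ∨ i = 15 ∨ i = 16 ∨ i = 17 := by decide
  have hone : p 14 = 1 ∨ p 15 = 1 ∨ p 16 = 1 ∨ p 17 = 1 := by omega
  refine hone.imp (fun h => ?_) (Or.imp (fun h => ?_) (Or.imp (fun h => ?_) (fun h => ?_)))
  · refine hext 14 (by decide) (by omega) h fun i hi hi' => ?_
    rcases hcases i hi' with rfl | rfl | rfl | rfl <;> first | exact absurd rfl hi | omega
  · refine hext 15 (by decide) (by omega) h fun i hi hi' => ?_
    rcases hcases i hi' with rfl | rfl | rfl | rfl <;> first | exact absurd rfl hi | omega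
  · refine hext 16 (by decide) (by omega) h fun i hi hi' => ?_
    rcases hcases i hi' with rfl | rfl | rfl | rfl <;> first | exact absurd rfl hi | omega
  · refine hext 17 (by decide) (by omega) h fun i hi hi' => ?_
    rcases hcases i hi' with rfl | rfl | rfl | rfl <;> first | exact absurd rfl hi | omega

theorem qip_diffSingle (i j : Fin 20) (x : Fin 20 → ℚ) : qip (diffSingle i j) x = x i - x j := by
  simp [qip, diffSingle, sub_mul, Finset.sum_sub_distrib, Pi.single_apply]

theorem diffSingle_left_injective (j : Fin 20) : Function.Injective fun i => diffSingle i j := by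
  intro i i' h
  by_contra hne
  have := congrFun (sub_left_injective h) i
  simp [hne] at this

/-- `w` lies in the Niemeier lattice `A_17 A_1`, has norm 5, is
extremal, and exactly 4 roots `u` satisfy `u·w = -2`; hence
`|Min(w+2L)/±| ≡ 1 + 4 ≡ 1 (mod 2)`. -/
theorem niemeierA17A1_w :
    wA17A1 ∈ NiemeierA17A1 ∧
    qip wA17A1 wA17A1 = 5 ∧
    (∀ u ∈ NiemeierA17A1,
      qip wA17A1 wA17A1 ≤ qip (wA17A1 + 2 • u) (wA17A1 + 2 • u)) ∧
    Nat.card {u : Fin 20 → ℚ |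
      u ∈ NiemeierA17A1 ∧ qip u u = 2 ∧ qip u wA17A1 = -2} = 4 ∧
    Odd (1 + Nat.card {u : Fin 20 → ℚ |
      u ∈ NiemeierA17A1 ∧ qip u u = 2 ∧ qip u wA17A1 = -2}) := by
  have hset : {u : Fin 20 → ℚ | u ∈ NiemeierA17A1 ∧ qip u u = 2 ∧ qip u wA17A1 = -2} =
      Set.image (fun j => diffSingle j 0)
        (({14, 15, 16, 17} : Finset (Fin 20)) : Set (Fin 20)) := by
    ext u
    constructor
    · rintro ⟨hu, hn, hw⟩
      rcases eq_diffSingle_of_root hu hn hw with rfl | rfl | rfl | rfl <;>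
        exact Set.mem_image_of_mem _ (by decide)
    · rintro ⟨j, hj, rfl⟩
      have hj' : 14 ≤ j.val ∧ j.val < 18 := by
        revert hj
        simp only [Finset.mem_coe]
        revert j
        decide
      refine ⟨diffSingle_mem hj'.2 (by decide), ?_, ?_⟩
      · have hj0 : j ≠ 0 := by rintro rfl; simp at hj'
        rw [qip_diffSingle]
        simp [diffSingle, hj0, hj0.symm]
        norm_num
      · have h0 : j.val ≠ 0 := by omega
        rw [qip_diffSingle]
        simp [wA17A1, h0, hj'.1.not_gt, hj'.2]
        norm_num
  have hcard : Nat.card {u : Fin 20 → ℚ |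
      u ∈ NiemeierA17A1 ∧ qip u u = 2 ∧ qip u wA17A1 = -2} = 4 := by
    rw [hset, Nat.card_image_of_injective (diffSingle_left_injective 0)]
    simp
  refine ⟨wA17A1_mem, qip_wA17A1_self, fun u hu => ?_, hcard, ?_⟩
  · rw [qip_wA17A1_self]
    exact wA17A1_extremal hu
  · rw [hcard]
    decide
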